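/- Let d = 4 and define the classical quartic invariants I = a₀a₄ − 4a₁a₃ + 3a₂² and J = a₀a₂a₄ + 2a₁a₂a₃ − a₂³ − a₀a₃² − a₁²a₄ in R = ℂ[a₀,…,a₄]. There is a dense Zariski-open subset U ⊆ ℂ⁵ such that for every E ∈ U, the vanishing ideal I_E of X_E is the principal ideal generated by the degree-6 polynomial J(E)²·I³ − I(E)³·J². -/

import Mathlib

/-!
Setup for the ideals of general binary orbits (Chipalkatti, "On the ideals of general
binary orbits: the low order cases").

A binary form `E = Σ_{i=0}^d binom(d,i) αᵢ x₁^{d−i} x₂^i` of order `d` over `ℂ` is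
identified with its coefficient vector `α : Fin (d+1) → ℂ`.  `SL₂(ℂ)` acts on binary
`d`-ics by substitution of variables, inducing an action `actCoeff` on `ℂ^{d+1}` and an
action `actPoly` on `R = ℂ[a_0, …, a_d]` (the polynomial ring `MvPolynomial (Fin (d+1)) ℂ`).

For `E ≠ 0`, `orbitVariety d E = X_E` is the Zariski closure of
`{λ • (g·E) : λ ∈ ℂ, g ∈ SL₂(ℂ)}` (the affine cone over the orbit closure `Ω_E ⊆ ℙ^d`),
and `orbitIdeal d E = I_E` is its vanishing ideal (automatically homogeneous).

`genPiece d m E = (I_E)_m`, `trivPiece d m E = (R₊·I_E)_m`, and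
`minGenSpace d m E = B(0,m) = (I_E/(R₊·I_E))_m` is the space of minimal generators in
degree `m`, with `betti d m E = β_m` its dimension.

`RepSum l` models the direct sum `⊕ᵢ S_{l i}` of the irreducible `SL₂(ℂ)`-representations
(binary forms of order `q`, via coefficient vectors), with action `repSumAct`.
-/

open MvPolynomial

noncomputable section

/-- The special linear group `SL₂(ℂ)`. -/
abbrev SL2 : Type := Matrix.SpecialLinearGroup (Fin 2) ℂ

/-- The binary form of order `d` with coefficient vector `α`:
`Σ_{i=0}^d binom(d,i) αᵢ x₁^{d−i} x₂^i`, with `x₁ = X 0`, `x₂ = X 1`. -/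
def toForm (d : ℕ) (α : Fin (d + 1) → ℂ) : MvPolynomial (Fin 2) ℂ :=
  ∑ i : Fin (d + 1), C ((d.choose (i : ℕ) : ℂ) * α i) * (X 0 ^ (d - (i : ℕ)) * X 1 ^ (i : ℕ))

/-- Substitution of variables by `g = [[p,q],[r,s]]`: `x₁ ↦ p x₁ + q x₂`, `x₂ ↦ r x₁ + s x₂`. -/
def substAction (g : SL2) (F : MvPolynomial (Fin 2) ℂ) : MvPolynomial (Fin 2) ℂ :=
  aeval (fun i : Fin 2 => C (g.1 i 0) * X 0 + C (g.1 i 1) * X 1) F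

/-- The coefficient vector of `g·E`, where `E` is the binary `d`-ic with coefficient
vector `α`: the coefficient of `x₁^{d−i} x₂^i` in `g·E`, divided by `binom(d,i)`. -/
def actCoeff (d : ℕ) (g : SL2) (α : Fin (d + 1) → ℂ) : Fin (d + 1) → ℂ := fun i =>
  coeff (Finsupp.single (0 : Fin 2) (d - (i : ℕ)) + Finsupp.single (1 : Fin 2) (i : ℕ))
      (substAction g (toForm d α)) / (d.choose (i : ℕ) : ℂ)

/-- The affine cone over the `SL₂(ℂ)`-orbit of `E`:
`{λ • (g·E) : λ ∈ ℂ, g ∈ SL₂(ℂ)} ⊆ ℂ^{d+1}`. -/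
def orbitCone (d : ℕ) (E : Fin (d + 1) → ℂ) : Set (Fin (d + 1) → ℂ) :=
  {v | ∃ (c : ℂ) (g : SL2), v = c • actCoeff d g E}

/-- The Zariski closure of a subset of affine space `ℂⁿ`: the set of points at which every
polynomial vanishing on `S` vanishes. -/
def zClosure {n : ℕ} (S : Set (Fin n → ℂ)) : Set (Fin n → ℂ) :=
  {v | ∀ f : MvPolynomial (Fin n) ℂ, (∀ w ∈ S, eval w f = 0) → eval v f = 0}

/-- A Zariski-open subset of `ℂⁿ`: the complement of the common zero locus of a family of
polynomials. -/
def IsZariskiOpen {n : ℕ} (U : Set (Fin n → ℂ)) : Prop :=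
  ∃ T : Set (MvPolynomial (Fin n) ℂ), U = {v | ∃ f ∈ T, eval v f ≠ 0}

/-- A Zariski-dense subset of `ℂⁿ`. -/
def IsZariskiDense {n : ℕ} (U : Set (Fin n → ℂ)) : Prop :=
  zClosure U = Set.univ

/-- A property `P` holds for a general `E ∈ ℂ^{d+1}` if it holds on some dense
Zariski-open subset of `ℂ^{d+1}`. -/
def ForGeneral (d : ℕ) (P : (Fin (d + 1) → ℂ) → Prop) : Prop :=
  ∃ U : Set (Fin (d + 1) → ℂ), IsZariskiOpen U ∧ IsZariskiDense U ∧ ∀ E ∈ U, P E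

/-- `X_E`: the Zariski closure of the affine cone over the orbit of `E` (the affine cone
over the orbit closure `Ω_E ⊆ ℙ^d`). -/
def orbitVariety (d : ℕ) (E : Fin (d + 1) → ℂ) : Set (Fin (d + 1) → ℂ) :=
  zClosure (orbitCone d E)

/-- `I_E`: the (homogeneous) vanishing ideal of `X_E` in `R = ℂ[a_0, …, a_d]`. -/
def orbitIdeal (d : ℕ) (E : Fin (d + 1) → ℂ) : Ideal (MvPolynomial (Fin (d + 1)) ℂ) where
  carrier := {f | ∀ v ∈ orbitVariety d E, eval v f = 0}
  zero_mem' := fun v _ => by simp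
  add_mem' := fun hf hh v hv => by simp [hf v hv, hh v hv]
  smul_mem' := fun c f hf v hv => by simp [smul_eq_mul, hf v hv]

/-- The linear polynomial expressing the `i`-th coordinate of `g·v` in terms of the
coordinates of `v`. -/
def actVarPoly (d : ℕ) (g : SL2) (i : Fin (d + 1)) : MvPolynomial (Fin (d + 1)) ℂ :=
  ∑ j : Fin (d + 1), C (actCoeff d g (Pi.single j 1) i) * X j

/-- The induced `SL₂(ℂ)`-action on `R = ℂ[a_0, …, a_d]`: `(g·f)(v) = f(g·v)`. -/
def actPoly (d : ℕ) (g : SL2) (f : MvPolynomial (Fin (d + 1)) ℂ) :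
    MvPolynomial (Fin (d + 1)) ℂ :=
  aeval (actVarPoly d g) f

/-- The degree-`m` graded piece of an ideal of `R`, as a `ℂ`-subspace. -/
def idealPiece (d m : ℕ) (I : Ideal (MvPolynomial (Fin (d + 1)) ℂ)) :
    Submodule ℂ (MvPolynomial (Fin (d + 1)) ℂ) :=
  Submodule.restrictScalars ℂ I ⊓ homogeneousSubmodule (Fin (d + 1)) ℂ m

/-- `(I_E)_m`, the degree-`m` graded piece of `I_E`. -/
def genPiece (d m : ℕ) (E : Fin (d + 1) → ℂ) :
    Submodule ℂ (MvPolynomial (Fin (d + 1)) ℂ) :=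
  idealPiece d m (orbitIdeal d E)

/-- The irrelevant maximal ideal `R₊ = (a_0, …, a_d)`. -/
def irrelevantIdeal (d : ℕ) : Ideal (MvPolynomial (Fin (d + 1)) ℂ) :=
  Ideal.span (Set.range X)

/-- `(R₊·I_E)_m`. -/
def trivPiece (d m : ℕ) (E : Fin (d + 1) → ℂ) :
    Submodule ℂ (MvPolynomial (Fin (d + 1)) ℂ) :=
  idealPiece d m (irrelevantIdeal d * orbitIdeal d E)

/-- `(R₊·I_E)_m` viewed inside `(I_E)_m`. -/
def minGenRel (d m : ℕ) (E : Fin (d + 1) → ℂ) : Submodule ℂ (genPiece d m E) :=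
  (trivPiece d m E).comap (genPiece d m E).subtype

/-- `B(0,m) = (I_E/(R₊·I_E))_m`, the degree-`m` space of minimal generators of `I_E`. -/
abbrev minGenSpace (d m : ℕ) (E : Fin (d + 1) → ℂ) : Type :=
  genPiece d m E ⧸ minGenRel d m E

/-- The canonical projection `(I_E)_m → B(0,m)`. -/
def minGenMk (d m : ℕ) (E : Fin (d + 1) → ℂ) : genPiece d m E →ₗ[ℂ] minGenSpace d m E :=
  (minGenRel d m E).mkQ

/-- `β_m = dim_ℂ B(0,m)`, the number of minimal generators of `I_E` in degree `m`. -/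
def betti (d m : ℕ) (E : Fin (d + 1) → ℂ) : ℕ :=
  Module.finrank ℂ (minGenSpace d m E)

/-- The direct sum `⊕ᵢ S_{l i}` of irreducible `SL₂(ℂ)`-representations, where `S_q`
(binary forms of order `q`) is modeled by coefficient vectors `Fin (q+1) → ℂ`. -/
abbrev RepSum (l : List ℕ) : Type :=
  ∀ i : Fin l.length, Fin (l.get i + 1) → ℂ

/-- The `SL₂(ℂ)`-action on `RepSum l`, by substitution on each binary form. -/
def repSumAct (l : List ℕ) (g : SL2) (v : RepSum l) : RepSum l :=
  fun i => actCoeff (l.get i) g (v i)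

/-- `B(0,m) ≅ S_{l 0} ⊕ ⋯ ⊕ S_{l k}` as `SL₂(ℂ)`-representations: there is a
`ℂ`-linear isomorphism intertwining the action induced on `B(0,m)` by the action on
`(I_E)_m ⊆ R` with the action on `⊕ᵢ S_{l i}`. -/
def HasMinGens (d m : ℕ) (E : Fin (d + 1) → ℂ) (l : List ℕ) : Prop :=
  ∃ e : minGenSpace d m E ≃ₗ[ℂ] RepSum l,
    ∀ (g : SL2) (f : MvPolynomial (Fin (d + 1)) ℂ)
      (hf : f ∈ genPiece d m E) (hgf : actPoly d g f ∈ genPiece d m E),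
      e (minGenMk d m E ⟨actPoly d g f, hgf⟩) = repSumAct l g (e (minGenMk d m E ⟨f, hf⟩))

end

open MvPolynomial in
/-- The degree-2 invariant `I = a₀a₄ − 4a₁a₃ + 3a₂²` of the binary quartic. -/
noncomputable def quarticI : MvPolynomial (Fin 5) ℂ :=
  X 0 * X 4 - 4 * (X 1 * X 3) + 3 * X 2 ^ 2

open MvPolynomial in
/-- The degree-3 invariant `J = a₀a₂a₄ + 2a₁a₂a₃ − a₂³ − a₀a₃² − a₁²a₄` of the binary
quartic. -/
noncomputable def quarticJ : MvPolynomial (Fin 5) ℂ :=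
  X 0 * X 2 * X 4 + 2 * (X 1 * X 2 * X 3) - X 2 ^ 3 - X 0 * X 3 ^ 2 - X 1 ^ 2 * X 4


/-- Every coefficient of a binary form is recovered from the form. -/
theorem coeff_toForm (d : ℕ) (α : Fin (d + 1) → ℂ) (i : Fin (d + 1)) :
    coeff (Finsupp.single (0 : Fin 2) (d - (i : ℕ)) + Finsupp.single (1 : Fin 2) (i : ℕ))
      (toForm d α) = (d.choose (i : ℕ) : ℂ) * α i := by
  have h : ∀ j : Fin (d + 1),
      (X 0 ^ (d - (j : ℕ)) * X 1 ^ (j : ℕ) : MvPolynomial (Fin 2) ℂ) =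
        monomial (Finsupp.single 0 (d - (j : ℕ)) + Finsupp.single 1 (j : ℕ)) 1 := fun j => by
    rw [X_pow_eq_monomial, X_pow_eq_monomial, monomial_mul, one_mul]
  simp only [toForm, coeff_sum, coeff_C_mul, h, coeff_monomial]
  rw [Finset.sum_eq_single i]
  · simp
  · intro j _ hj
    rw [if_neg, mul_zero]
    intro he
    have := DFunLike.congr_fun he 1
    simp only [Finsupp.add_apply, Finsupp.single_apply] at this
    exact hj (Fin.ext (by simpa using this))
  · simp

theorem actCoeff_eq_of_substAction_eq {d : ℕ} {g : SL2} {α β : Fin (d + 1) → ℂ}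
    (h : substAction g (toForm d α) = toForm d β) : actCoeff d g α = β := by
  funext i
  have hi : (d.choose (i : ℕ) : ℂ) ≠ 0 :=
    Nat.cast_ne_zero.2 (Nat.choose_pos (Nat.lt_succ_iff.1 i.2)).ne'
  rw [actCoeff, h, coeff_toForm, mul_div_cancel_left₀ _ hi]

theorem substAction_substAction (g h : SL2) (F : MvPolynomial (Fin 2) ℂ) :
    substAction g (substAction h F) = substAction (h * g) F := by
  unfold substAction
  rw [← AlgHom.comp_apply]
  refine DFunLike.congr_fun (algHom_ext fun i => ?_) F
  simp only [AlgHom.comp_apply, aeval_X, map_add, map_mul, algHom_C, algebraMap_eq,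
    Matrix.SpecialLinearGroup.coe_mul, Matrix.mul_apply, Fin.sum_univ_two]
  ring

theorem substAction_one (F : MvPolynomial (Fin 2) ℂ) : substAction 1 F = F := by
  have : (aeval fun i : Fin 2 => C ((1 : SL2).1 i 0) * X 0 + C ((1 : SL2).1 i 1) * X 1) =
      AlgHom.id ℂ (MvPolynomial (Fin 2) ℂ) := by
    refine algHom_ext fun i => ?_
    fin_cases i <;> simp
  rw [substAction, this, AlgHom.id_apply]

theorem toForm_four (α : Fin 5 → ℂ) :
    toForm 4 α = C (α 0) * X 0 ^ 4 + 4 * C (α 1) * (X 0 ^ 3 * X 1) +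
      6 * C (α 2) * (X 0 ^ 2 * X 1 ^ 2) + 4 * C (α 3) * (X 0 * X 1 ^ 3) + C (α 4) * X 1 ^ 4 := by
  simp [toForm, Fin.sum_univ_succ, Nat.choose]
  ring

/-- The coefficient vector of the quartic `v` after the substitution
`x₁ ↦ p x₁ + q x₂`, `x₂ ↦ r x₁ + s x₂`. -/
def quarticSubst (p q r s : ℂ) (v : Fin 5 → ℂ) : Fin 5 → ℂ :=
  ![v 0 * p ^ 4 + 4 * v 1 * p ^ 3 * r + 6 * v 2 * p ^ 2 * r ^ 2 + 4 * v 3 * p * r ^ 3 +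
      v 4 * r ^ 4,
    v 0 * p ^ 3 * q + v 1 * (p ^ 3 * s + 3 * p ^ 2 * q * r) +
      3 * v 2 * (p ^ 2 * r * s + p * q * r ^ 2) + v 3 * (3 * p * r ^ 2 * s + q * r ^ 3) +
      v 4 * r ^ 3 * s,
    v 0 * p ^ 2 * q ^ 2 + 2 * v 1 * (p ^ 2 * q * s + p * q ^ 2 * r) +
      v 2 * (p ^ 2 * s ^ 2 + 4 * p * q * r * s + q ^ 2 * r ^ 2) +
      2 * v 3 * (p * r * s ^ 2 + q * r ^ 2 * s) + v 4 * r ^ 2 * s ^ 2,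
    v 0 * p * q ^ 3 + v 1 * (3 * p * q ^ 2 * s + q ^ 3 * r) +
      3 * v 2 * (p * q * s ^ 2 + q ^ 2 * r * s) + v 3 * (p * s ^ 3 + 3 * q * r * s ^ 2) +
      v 4 * r * s ^ 3,
    v 0 * q ^ 4 + 4 * v 1 * q ^ 3 * s + 6 * v 2 * q ^ 2 * s ^ 2 + 4 * v 3 * q * s ^ 3 +
      v 4 * s ^ 4]

theorem substAction_toForm_four (g : SL2) (v : Fin 5 → ℂ) :
    substAction g (toForm 4 v) =
      toForm 4 (quarticSubst (g.1 0 0) (g.1 0 1) (g.1 1 0) (g.1 1 1) v) := by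
  rw [toForm_four, toForm_four]
  simp only [substAction, quarticSubst, map_add, map_mul, map_pow, map_ofNat, aeval_X, algHom_C,
    algebraMap_eq, Matrix.cons_val]
  ring

theorem actCoeff_four (g : SL2) (v : Fin 5 → ℂ) :
    actCoeff 4 g v = quarticSubst (g.1 0 0) (g.1 0 1) (g.1 1 0) (g.1 1 1) v :=
  actCoeff_eq_of_substAction_eq (substAction_toForm_four g v)

theorem toForm_actCoeff_four (g : SL2) (v : Fin 5 → ℂ) :
    toForm 4 (actCoeff 4 g v) = substAction g (toForm 4 v) := by
  rw [actCoeff_four, substAction_toForm_four]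

theorem actCoeff_four_actCoeff_four (g h : SL2) (v : Fin 5 → ℂ) :
    actCoeff 4 g (actCoeff 4 h v) = actCoeff 4 (h * g) v :=
  actCoeff_eq_of_substAction_eq <| by
    rw [toForm_actCoeff_four, toForm_actCoeff_four, substAction_substAction]

theorem actCoeff_four_one (v : Fin 5 → ℂ) : actCoeff 4 1 v = v :=
  actCoeff_eq_of_substAction_eq (substAction_one _)

theorem eval_quarticI (v : Fin 5 → ℂ) :
    eval v quarticI = v 0 * v 4 - 4 * (v 1 * v 3) + 3 * v 2 ^ 2 := by
  simp [quarticI]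

theorem eval_quarticJ (v : Fin 5 → ℂ) :
    eval v quarticJ = v 0 * v 2 * v 4 + 2 * (v 1 * v 2 * v 3) - v 2 ^ 3 - v 0 * v 3 ^ 2 -
      v 1 ^ 2 * v 4 := by
  simp [quarticJ]

theorem SL2_det (g : SL2) : g.1 0 0 * g.1 1 1 - g.1 0 1 * g.1 1 0 = 1 := by
  rw [← Matrix.det_fin_two, g.2]

theorem eval_actCoeff_quarticI (g : SL2) (v : Fin 5 → ℂ) :
    eval (actCoeff 4 g v) quarticI = eval v quarticI := by
  rw [actCoeff_four, eval_quarticI, eval_quarticI]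
  trans (g.1 0 0 * g.1 1 1 - g.1 0 1 * g.1 1 0) ^ 4 *
    (v 0 * v 4 - 4 * (v 1 * v 3) + 3 * v 2 ^ 2)
  · simp only [quarticSubst, Matrix.cons_val]
    ring
  · rw [SL2_det, one_pow, one_mul]

theorem eval_actCoeff_quarticJ (g : SL2) (v : Fin 5 → ℂ) :
    eval (actCoeff 4 g v) quarticJ = eval v quarticJ := by
  rw [actCoeff_four, eval_quarticJ, eval_quarticJ]
  trans (g.1 0 0 * g.1 1 1 - g.1 0 1 * g.1 1 0) ^ 6 *
    (v 0 * v 2 * v 4 + 2 * (v 1 * v 2 * v 3) - v 2 ^ 3 - v 0 * v 3 ^ 2 - v 1 ^ 2 * v 4)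
  · simp only [quarticSubst, Matrix.cons_val]
    ring
  · rw [SL2_det, one_pow, one_mul]

theorem eval_smul_quarticI (c : ℂ) (v : Fin 5 → ℂ) :
    eval (c • v) quarticI = c ^ 2 * eval v quarticI := by
  simp only [eval_quarticI, Pi.smul_apply, smul_eq_mul]
  ring

theorem eval_smul_quarticJ (c : ℂ) (v : Fin 5 → ℂ) :
    eval (c • v) quarticJ = c ^ 3 * eval v quarticJ := by
  simp only [eval_quarticJ, Pi.smul_apply, smul_eq_mul]
  ring

/-- A linear change of variables moves a root of a binary quartic to `(1 : 0)`. -/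
theorem exists_actCoeff_zero_eq_zero (v : Fin 5 → ℂ) : ∃ g : SL2, actCoeff 4 g v 0 = 0 := by
  by_cases h0 : v 0 = 0
  · exact ⟨1, by rw [actCoeff_four_one, h0]⟩
  · obtain ⟨x, hx⟩ := IsAlgClosed.exists_root
      (Polynomial.C (v 0) * Polynomial.X ^ 4 + Polynomial.C (4 * v 1) * Polynomial.X ^ 3 +
        Polynomial.C (6 * v 2) * Polynomial.X ^ 2 + Polynomial.C (4 * v 3) * Polynomial.X +
        Polynomial.C (v 4)) (by
      have : Polynomial.degree
          (Polynomial.C (v 0) * Polynomial.X ^ 4 + Polynomial.C (4 * v 1) * Polynomial.X ^ 3 +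
          Polynomial.C (6 * v 2) * Polynomial.X ^ 2 + Polynomial.C (4 * v 3) * Polynomial.X +
          Polynomial.C (v 4)) = 4 := by compute_degree!
      rw [this]
      decide)
    let g : SL2 := ⟨!![x, -1; 1, 0], by simp [Matrix.det_fin_two]⟩
    refine ⟨g, ?_⟩
    have hg : actCoeff 4 g v = quarticSubst x (-1) 1 0 v := by
      rw [actCoeff_four]
      simp [g]
    rw [hg]
    simp only [Polynomial.IsRoot.def, Polynomial.eval_add, Polynomial.eval_mul,
      Polynomial.eval_C, Polynomial.eval_pow, Polynomial.eval_X] at hx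
    simp [quarticSubst]
    linear_combination hx

/-- A binary quartic with nonzero discriminant is equivalent to a quartic in Weierstrass form,
which is determined by its invariants. -/
theorem exists_actCoeff_eq_weierstrass (v : Fin 5 → ℂ)
    (hv : eval v quarticI ^ 3 ≠ 27 * eval v quarticJ ^ 2) :
    ∃ g : SL2, actCoeff 4 g v = ![0, 1, 0, -eval v quarticI / 4, -eval v quarticJ] := by
  obtain ⟨g, hg⟩ := exists_actCoeff_zero_eq_zero v
  set b := actCoeff 4 g v with hb
  have hI : eval b quarticI = eval v quarticI := eval_actCoeff_quarticI g v
  have hJ : eval b quarticJ = eval v quarticJ := eval_actCoeff_quarticJ g v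
  have hb1 : b 1 ≠ 0 := by
    intro h1
    apply hv
    rw [← hI, ← hJ, eval_quarticI, eval_quarticJ, hg, h1]
    ring
  obtain ⟨t, ht⟩ := IsAlgClosed.exists_pow_nat_eq (b 1)⁻¹ (n := 2) two_pos
  have ht' : t ^ 2 * b 1 = 1 := by rw [ht, inv_mul_cancel₀ hb1]
  have ht0 : t ≠ 0 := by
    rintro rfl
    simp at ht'
  let k : SL2 := ⟨!![t, -t * b 2 / 2; 0, t⁻¹], by simp [Matrix.det_fin_two, ht0]⟩
  refine ⟨g * k, ?_⟩
  rw [← actCoeff_four_actCoeff_four, ← hb]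
  set w := actCoeff 4 k b with hw
  have hwI : eval w quarticI = eval v quarticI := (eval_actCoeff_quarticI k b).trans hI
  have hwJ : eval w quarticJ = eval v quarticJ := (eval_actCoeff_quarticJ k b).trans hJ
  have hws : w = quarticSubst t (-t * b 2 / 2) 0 t⁻¹ b := by
    rw [hw, actCoeff_four]
    simp [k]
  have w0 : w 0 = 0 := by
    rw [hws]
    simp [quarticSubst, hg]
  have w1 : w 1 = 1 := by
    rw [hws]
    simp only [quarticSubst, Matrix.cons_val, hg]
    field_simp
    linear_combination 2 * t * ht'
  have w2 : w 2 = 0 := by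
    rw [hws]
    simp only [quarticSubst, Matrix.cons_val, hg]
    field_simp
    linear_combination (-4 * t ^ 2 * b 2) * ht'
  rw [eval_quarticI, w0, w1, w2] at hwI
  rw [eval_quarticJ, w0, w1, w2] at hwJ
  funext i
  fin_cases i
  · exact w0
  · exact w1
  · exact w2
  · change w 3 = -eval v quarticI / 4
    linear_combination -hwI / 4
  · change w 4 = -eval v quarticJ
    linear_combination -hwJ

/-- A point on the hypersurface `J(E)² I³ = I(E)³ J²` with nonzero `I` lies in the cone over the
orbit of `E`. -/
theorem mem_orbitCone_four {E v : Fin 5 → ℂ} (hIE : eval E quarticI ≠ 0)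
    (hJE : eval E quarticJ ≠ 0) (hE : eval E quarticI ^ 3 ≠ 27 * eval E quarticJ ^ 2)
    (hv : eval E quarticJ ^ 2 * eval v quarticI ^ 3 = eval E quarticI ^ 3 * eval v quarticJ ^ 2)
    (hIv : eval v quarticI ≠ 0) : v ∈ orbitCone 4 E := by
  have hJv : eval v quarticJ ≠ 0 := by
    intro h
    rw [h] at hv
    simp [hIv, hJE] at hv
  set c := eval v quarticJ * eval E quarticI / (eval v quarticI * eval E quarticJ) with hc
  have hc0 : c ≠ 0 := by positivity
  have hI : eval (c⁻¹ • v) quarticI = eval E quarticI := by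
    rw [eval_smul_quarticI, hc]
    field_simp
    linear_combination hv
  have hJ : eval (c⁻¹ • v) quarticJ = eval E quarticJ := by
    rw [eval_smul_quarticJ, hc]
    field_simp
    linear_combination hv
  obtain ⟨g, hg⟩ := exists_actCoeff_eq_weierstrass E hE
  obtain ⟨h, hh⟩ := exists_actCoeff_eq_weierstrass (c⁻¹ • v) (by rwa [hI, hJ])
  rw [hI, hJ, ← hg] at hh
  refine ⟨c, g * h⁻¹, ?_⟩
  rw [← actCoeff_four_actCoeff_four, ← hh, actCoeff_four_actCoeff_four, mul_inv_cancel,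
    actCoeff_four_one, smul_inv_smul₀ hc0]

/-- A polynomial over a ring of multivariate polynomials that vanishes on the part of the
hypersurface `F = 0` where `G ≠ 0` is divisible by `F`, provided that `F` is monic and that some
specialization of `F` is separable and coprime to that of `G`. -/
theorem monic_dvd_of_eval_eq_zero {σ : Type*}
    {F f G : Polynomial (MvPolynomial σ ℂ)} (hF : F.Monic) (hdeg : F.natDegree ≠ 0)
    (s₀ : σ → ℂ)
    (hcop : IsCoprime (F.map (eval s₀)) ((Polynomial.derivative F * G).map (eval s₀)))
    (hf : ∀ (s : σ → ℂ) (y : ℂ), (F.map (eval s)).eval y = 0 → (G.map (eval s)).eval y ≠ 0 →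
      (f.map (eval s)).eval y = 0) :
    F ∣ f := by
  classical
  set H := Polynomial.derivative F * G with hH
  set D := Polynomial.resultant F H with hD
  have hD0 : eval s₀ D ≠ 0 := by
    have hu := (Polynomial.isUnit_resultant_iff_isCoprime (hF.map (eval s₀))).2 hcop
    have hle : (H.map (eval s₀)).natDegree ≤ H.natDegree := Polynomial.natDegree_map_le
    obtain ⟨k, hk⟩ := Nat.exists_eq_add_of_le hle
    rw [hD, ← Polynomial.resultant_map_map, hk,
      Polynomial.resultant_add_right_deg _ _ _ _ _ le_rfl, Polynomial.coeff_map,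
      hF.coeff_natDegree, map_one, one_pow, one_mul]
    rw [hF.natDegree_map] at hu
    exact hu.ne_zero
  obtain ⟨p, q, -, -, hpq⟩ := Polynomial.exists_mul_add_mul_eq_C_resultant F H le_rfl le_rfl
    (Or.inl hdeg)
  set r := f %ₘ F with hr
  have hrdeg : r.natDegree < F.natDegree :=
    Polynomial.natDegree_modByMonic_lt f hF fun h => hdeg (by simp [h])
  have hmap : ∀ s : σ → ℂ, eval s D ≠ 0 → r.map (eval s) = 0 := by
    intro s hs
    have hFs := hF.map (eval s)
    have hb : F.map (eval s) * p.map (eval s) + (Polynomial.derivative F).map (eval s) *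
        G.map (eval s) * q.map (eval s) = Polynomial.C (eval s D) := by
      simpa [hH] using congrArg (Polynomial.map (eval s)) hpq
    have hsep : (F.map (eval s)).Separable := by
      refine ⟨Polynomial.C (eval s D)⁻¹ * p.map (eval s),
        Polynomial.C (eval s D)⁻¹ * (G.map (eval s) * q.map (eval s)), ?_⟩
      have h1 : Polynomial.C (eval s D)⁻¹ * Polynomial.C (eval s D) = (1 : Polynomial ℂ) := by
        rw [← Polynomial.C_mul, inv_mul_cancel₀ hs, Polynomial.C_1]
      rw [Polynomial.derivative_map]
      linear_combination Polynomial.C (eval s D)⁻¹ * hb + h1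
    have hcard : (F.map (eval s)).roots.toFinset.card = F.natDegree := by
      rw [Multiset.toFinset_card_of_nodup (Polynomial.nodup_roots hsep),
        ← (IsAlgClosed.splits (F.map (eval s))).natDegree_eq_card_roots, hF.natDegree_map]
    refine Polynomial.eq_zero_of_natDegree_lt_card_of_eval_eq_zero' _
      (F.map (eval s)).roots.toFinset (fun y hy => ?_) ?_
    · have hy0 : (F.map (eval s)).eval y = 0 :=
        (Polynomial.mem_roots'.1 (Multiset.mem_toFinset.1 hy)).2
      have hG : (G.map (eval s)).eval y ≠ 0 := by
        intro h0
        have := congrArg (Polynomial.eval y) hb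
        simp only [Polynomial.eval_add, Polynomial.eval_mul, hy0, h0, Polynomial.eval_C] at this
        exact hs (by simpa using this.symm)
      have h := hf s y hy0 hG
      rw [← Polynomial.modByMonic_add_div f F] at h
      simpa [hy0] using h
    · rw [hcard]
      exact Polynomial.natDegree_map_le.trans_lt hrdeg
  rw [← Polynomial.modByMonic_eq_zero_iff_dvd hF, ← hr]
  ext1 n
  have hD' : D ≠ 0 := fun h => hD0 (by simp [h])
  refine (mul_eq_zero.1 (?_ : D * r.coeff n = 0)).resolve_left hD'
  refine MvPolynomial.funext fun s => ?_
  by_cases hs : eval s D = 0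
  · simp [hs]
  · have := congrArg (fun P => Polynomial.coeff P n) (hmap s hs)
    simp only [Polynomial.coeff_map, Polynomial.coeff_zero] at this
    simp [this]

/-- The quartic coefficient vectors as polynomials in the middle coefficient `a₂`. -/
noncomputable def middleVarEquiv :
    MvPolynomial (Fin 5) ℂ ≃ₐ[ℂ] Polynomial (MvPolynomial (Fin 4) ℂ) :=
  (renameEquiv ℂ (Equiv.swap (0 : Fin 5) 2)).trans (finSuccEquiv ℂ 4)

theorem eval_map_middleVarEquiv (s : Fin 4 → ℂ) (y : ℂ) (f : MvPolynomial (Fin 5) ℂ) :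
    ((middleVarEquiv f).map (eval s)).eval y = eval ![s 1, s 0, y, s 2, s 3] f := by
  have h : (Fin.cons y s : Fin 5 → ℂ) ∘ Equiv.swap (0 : Fin 5) 2 =
      ![s 1, s 0, y, s 2, s 3] := by
    funext i
    fin_cases i <;> rfl
  rw [middleVarEquiv, AlgEquiv.trans_apply, ← eval_eq_eval_mv_eval', renameEquiv_apply,
    eval_rename, h]

theorem middleVarEquiv_X : middleVarEquiv (X 0) = Polynomial.C (X 1) ∧
    middleVarEquiv (X 1) = Polynomial.C (X 0) ∧ middleVarEquiv (X 2) = Polynomial.X ∧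
    middleVarEquiv (X 3) = Polynomial.C (X 2) ∧ middleVarEquiv (X 4) = Polynomial.C (X 3) := by
  have h (i : Fin 5) :
      middleVarEquiv (X i) = finSuccEquiv ℂ 4 (X (Equiv.swap (0 : Fin 5) 2 i)) := by
    simp [middleVarEquiv]
  refine ⟨?_, ?_, ?_, ?_, ?_⟩ <;> rw [h]
  · exact finSuccEquiv_X_succ (j := 1)
  · exact finSuccEquiv_X_succ (j := 0)
  · exact finSuccEquiv_X_zero
  · exact finSuccEquiv_X_succ (j := 2)
  · exact finSuccEquiv_X_succ (j := 3)

theorem middleVarEquiv_C (c : ℂ) : middleVarEquiv (C c) = Polynomial.C (C c) := by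
  rw [← algebraMap_eq, AlgEquiv.commutes]
  rfl

/-- The polynomial `α I³ - β J²` is, up to a constant factor, monic of degree six in `a₂`. -/
theorem monic_middleVarEquiv {α β : ℂ} (h : 27 * α - β ≠ 0) :
    (middleVarEquiv (C (27 * α - β)⁻¹ * (C α * quarticI ^ 3 - C β * quarticJ ^ 2))).Monic ∧
    (middleVarEquiv (C (27 * α - β)⁻¹ * (C α * quarticI ^ 3 - C β * quarticJ ^ 2))).natDegree =
      6 := by
  obtain ⟨h0, h1, h2, h3, h4⟩ := middleVarEquiv_X
  set u := (27 * α - β)⁻¹ with hu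
  set i₀ : MvPolynomial (Fin 4) ℂ := X 1 * X 3 - 4 * (X 0 * X 2) with hi
  set j₁ : MvPolynomial (Fin 4) ℂ := X 1 * X 3 + 2 * (X 0 * X 2) with hj
  set j₀ : MvPolynomial (Fin 4) ℂ := -(X 1 * X 2 ^ 2) - X 0 ^ 2 * X 3 with hj0
  have hI : middleVarEquiv quarticI = 3 * Polynomial.X ^ 2 + Polynomial.C i₀ := by
    simp only [quarticI, map_add, map_sub, map_mul, map_pow, map_ofNat, h0, h1, h2, h3, h4, hi]
    ring
  have hJ : middleVarEquiv quarticJ =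
      -Polynomial.X ^ 3 + Polynomial.C j₁ * Polynomial.X + Polynomial.C j₀ := by
    simp only [quarticJ, map_add, map_sub, map_neg, map_mul, map_pow, map_ofNat, h0, h1, h2, h3,
      h4, hj, hj0]
    ring
  have hinv : (Polynomial.C (C u) * (27 * Polynomial.C (C α) - Polynomial.C (C β)) :
      Polynomial (MvPolynomial (Fin 4) ℂ)) = 1 := by
    have : u * (27 * α - β) = 1 := inv_mul_cancel₀ h
    simpa only [map_mul, map_sub, map_ofNat, map_one] using
      congrArg (fun c : ℂ => Polynomial.C (C (σ := Fin 4) c)) this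
  have hF : middleVarEquiv (C u * (C α * quarticI ^ 3 - C β * quarticJ ^ 2)) =
      Polynomial.X ^ 6 + (Polynomial.C (C u * (27 * C α * i₀ + 2 * C β * j₁)) * Polynomial.X ^ 4 +
        Polynomial.C (C u * (2 * C β * j₀)) * Polynomial.X ^ 3 +
        Polynomial.C (C u * (9 * C α * i₀ ^ 2 - C β * j₁ ^ 2)) * Polynomial.X ^ 2 +
        Polynomial.C (C u * (-2 * C β * j₁ * j₀)) * Polynomial.X +
        Polynomial.C (C u * (C α * i₀ ^ 3 - C β * j₀ ^ 2))) := by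
    simp only [map_add, map_sub, map_neg, map_mul, map_pow, map_ofNat, middleVarEquiv_C, hI, hJ]
    linear_combination Polynomial.X ^ 6 * hinv
  rw [hF]
  set P := Polynomial.C (C u * (27 * C α * i₀ + 2 * C β * j₁)) * Polynomial.X ^ 4 +
    Polynomial.C (C u * (2 * C β * j₀)) * Polynomial.X ^ 3 +
    Polynomial.C (C u * (9 * C α * i₀ ^ 2 - C β * j₁ ^ 2)) * Polynomial.X ^ 2 +
    Polynomial.C (C u * (-2 * C β * j₁ * j₀)) * Polynomial.X +
    Polynomial.C (C u * (C α * i₀ ^ 3 - C β * j₀ ^ 2)) with hP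
  have hdeg : P.degree < 6 := by
    have : P.degree ≤ 4 := by
      rw [hP]
      compute_degree
    exact this.trans_lt (by decide)
  exact ⟨Polynomial.monic_X_pow_add hdeg, by
    rw [Polynomial.natDegree_add_eq_left_of_degree_lt (by simpa using hdeg),
      Polynomial.natDegree_X_pow]⟩

/-- At `a = (1, 0, x, 0, 1)`, the polynomials `α I³ - β J²` and `I` have no common root, and
`α I³ - β J²` has no multiple root. -/
theorem no_common_root {α β y : ℂ} (hα : α ≠ 0) (hβ : β ≠ 0) (h : 27 * α - β ≠ 0)
    (hF : α * (1 + 3 * y ^ 2) ^ 3 - β * (y - y ^ 3) ^ 2 = 0)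
    (hd : (α * (18 * y * (1 + 3 * y ^ 2) ^ 2) - β * (2 * (y - y ^ 3) * (1 - 3 * y ^ 2))) *
      (1 + 3 * y ^ 2) = 0) : False := by
  have hI : 1 + 3 * y ^ 2 ≠ 0 := by
    intro hI
    rw [hI] at hF
    have h1 : y ^ 2 = -1 / 3 := by linear_combination hI / 3
    have h2 : β * (y ^ 2 * (1 - y ^ 2) ^ 2) = 0 := by linear_combination -hF
    rw [h1] at h2
    norm_num at h2
    exact hβ h2
  have hy : y ≠ 0 := by
    rintro rfl
    norm_num at hF
    exact hα hF
  have hJ : 1 - y ^ 2 ≠ 0 := by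
    intro h1
    have h2 : y ^ 2 = 1 := by linear_combination -h1
    have h3 : α * (1 + 3 * y ^ 2) ^ 3 - β * (y ^ 2 * (1 - y ^ 2) ^ 2) = 0 := by
      linear_combination hF
    rw [h2] at h3
    norm_num at h3
    exact hα h3
  have hd' := (mul_eq_zero.1 hd).resolve_right hI
  have h9 : 9 * y ^ 2 = 1 := by
    have : (2 * β * y * (1 - y ^ 2)) * (9 * y ^ 2 - 1) = 0 := by
      have h18 : y * ((2 * β * y * (1 - y ^ 2)) * (9 * y ^ 2 - 1)) = 0 := by
        linear_combination y * hd' * (1 + 3 * y ^ 2) - 18 * y ^ 2 * hF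
      exact (mul_eq_zero.1 h18).resolve_left hy
    have h2 := (mul_eq_zero.1 this).resolve_left
      (mul_ne_zero (mul_ne_zero (mul_ne_zero two_ne_zero hβ) hy) hJ)
    linear_combination h2
  have h1 : y ^ 2 = 1 / 9 := by linear_combination h9 / 9
  have h3 : α * (1 + 3 * y ^ 2) ^ 3 - β * (y ^ 2 * (1 - y ^ 2) ^ 2) = 0 := by
    linear_combination hF
  rw [h1] at h3
  apply h
  linear_combination 729 / 64 * h3

theorem dvd_of_forall_eval_eq_zero {α β : ℂ} (hα : α ≠ 0) (hβ : β ≠ 0) (h : 27 * α - β ≠ 0)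
    {f : MvPolynomial (Fin 5) ℂ}
    (hf : ∀ v, eval v (C α * quarticI ^ 3 - C β * quarticJ ^ 2) = 0 → eval v quarticI ≠ 0 →
      eval v f = 0) :
    C α * quarticI ^ 3 - C β * quarticJ ^ 2 ∣ f := by
  set F : MvPolynomial (Fin 5) ℂ := C α * quarticI ^ 3 - C β * quarticJ ^ 2 with hFdef
  set u := (27 * α - β)⁻¹ with hu
  have hu0 : u ≠ 0 := inv_ne_zero h
  obtain ⟨hmonic, hdeg⟩ := monic_middleVarEquiv h
  rw [← hFdef, ← hu] at hmonic hdeg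
  refine dvd_trans (Dvd.intro_left (C u) rfl) ((map_dvd_iff middleVarEquiv).1 ?_)
  have hev (s : Fin 4 → ℂ) (y : ℂ) :
      ((middleVarEquiv (C u * F)).map (eval s)).eval y =
        u * eval ![s 1, s 0, y, s 2, s 3] F := by
    rw [eval_map_middleVarEquiv, map_mul, eval_C]
  refine monic_dvd_of_eval_eq_zero (G := middleVarEquiv quarticI) hmonic (by rw [hdeg]; decide)
    ![0, 1, 0, 1] ?_ ?_
  · have hbase : (middleVarEquiv (C u * F)).map (eval ![0, 1, 0, 1]) =
        Polynomial.C u * (Polynomial.C α * (1 + 3 * Polynomial.X ^ 2) ^ 3 -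
          Polynomial.C β * (Polynomial.X - Polynomial.X ^ 3) ^ 2) := by
      refine Polynomial.funext fun y => ?_
      rw [hev]
      simp [hFdef, eval_quarticI, eval_quarticJ]
    refine (Polynomial.isCoprime_iff_aeval_ne_zero_of_isAlgClosed (k := ℂ) ℂ _ _).2 fun y => ?_
    by_contra! hy
    obtain ⟨hy1, hy2⟩ := hy
    rw [Polynomial.map_mul, ← Polynomial.derivative_map, hbase] at hy2
    rw [hbase] at hy1
    simp only [Polynomial.coe_aeval_eq_eval, Polynomial.eval_mul] at hy1 hy2
    rw [eval_map_middleVarEquiv, eval_quarticI] at hy2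
    simp [hu0, Polynomial.derivative_pow] at hy1 hy2
    refine no_common_root hα hβ h (y := y) hy1 ?_
    rcases hy2 with hy2 | hy2
    · linear_combination (1 + 3 * y ^ 2) * hy2
    · rw [hy2, mul_zero]
  · intro s y h1 h2
    rw [hev] at h1
    rw [eval_map_middleVarEquiv] at h2 ⊢
    exact hf _ ((mul_eq_zero.1 h1).resolve_left hu0) h2

theorem eval_eq_zero_of_mem_orbitCone_four {E v : Fin 5 → ℂ} (hv : v ∈ orbitCone 4 E) :
    eval v (C (eval E quarticJ) ^ 2 * quarticI ^ 3 - C (eval E quarticI) ^ 3 * quarticJ ^ 2) =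
      0 := by
  obtain ⟨c, g, rfl⟩ := hv
  have hI : eval (c • actCoeff 4 g E) quarticI = c ^ 2 * eval E quarticI :=
    (eval_smul_quarticI c _).trans (by rw [eval_actCoeff_quarticI])
  have hJ : eval (c • actCoeff 4 g E) quarticJ = c ^ 3 * eval E quarticJ :=
    (eval_smul_quarticJ c _).trans (by rw [eval_actCoeff_quarticJ])
  simp only [map_sub, map_mul, map_pow, eval_C, hI, hJ]
  ring

theorem mem_orbitIdeal_iff {d : ℕ} {E : Fin (d + 1) → ℂ} {f : MvPolynomial (Fin (d + 1)) ℂ} :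
    f ∈ orbitIdeal d E ↔ ∀ v ∈ orbitCone d E, eval v f = 0 :=
  ⟨fun h v hv => h v fun _ hg => hg v hv, fun h _ hv => hv f h⟩

/-- The complement of a hypersurface is Zariski dense. -/
theorem isZariskiDense_eval_ne_zero {n : ℕ} {h : MvPolynomial (Fin n) ℂ} (hh : h ≠ 0) :
    IsZariskiDense {v | eval v h ≠ 0} := by
  refine Set.eq_univ_of_forall fun v f hf => ?_
  have : f * h = 0 := MvPolynomial.funext fun w => by
    by_cases hw : eval w h = 0
    · simp [hw]
    · simp [hf w hw]
  simp [(mul_eq_zero.1 this).resolve_right hh]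

/-- For `d = 4` there is a dense Zariski-open `U ⊆ ℂ⁵` such that for every
`E ∈ U` the vanishing ideal `I_E` of `X_E` is the principal ideal generated by the
degree-6 polynomial `J(E)²·I³ − I(E)³·J²`. -/
theorem quartic_orbit_ideal_principal :
    ∃ U : Set (Fin 5 → ℂ), IsZariskiOpen U ∧ IsZariskiDense U ∧
      ∀ E ∈ U, orbitIdeal 4 E =
        Ideal.span
          {MvPolynomial.C (MvPolynomial.eval E quarticJ) ^ 2 * quarticI ^ 3 -
            MvPolynomial.C (MvPolynomial.eval E quarticI) ^ 3 * quarticJ ^ 2} := by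
  refine ⟨{v | eval v (quarticI * quarticJ * (quarticI ^ 3 - 27 * quarticJ ^ 2)) ≠ 0},
    ⟨{quarticI * quarticJ * (quarticI ^ 3 - 27 * quarticJ ^ 2)}, by simp⟩,
    isZariskiDense_eval_ne_zero fun h => ?_, fun E hE => ?_⟩
  · have := congrArg (eval ![1, 0, 1, 0, 2]) h
    simp [eval_quarticI, eval_quarticJ] at this
    norm_num at this
  · simp only [Set.mem_ofPred_eq, map_mul, map_sub, map_pow, map_ofNat, mul_ne_zero_iff,
      sub_ne_zero] at hE
    obtain ⟨⟨hI, hJ⟩, hIJ⟩ := hE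
    ext f
    rw [Ideal.mem_span_singleton, mem_orbitIdeal_iff]
    constructor
    · intro hf
      rw [← C_pow, ← C_pow]
      refine dvd_of_forall_eval_eq_zero (pow_ne_zero 2 hJ) (pow_ne_zero 3 hI)
        (fun h => hIJ (by linear_combination -h)) fun v hv hIv => ?_
      refine hf v (mem_orbitCone_four hI hJ hIJ ?_ hIv)
      simp only [map_sub, map_mul, map_pow, eval_C] at hv
      linear_combination hv
    · rintro ⟨q, rfl⟩ v hv
      rw [map_mul, eval_eq_zero_of_mem_orbitCone_four hv, zero_mul]
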